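/- Consider a DMC W with finite input alphabet X containing the 'off' symbol 0 and finite output alphabet Y, with Q0 = W(·|0) and supp(Q0) = Y, and fix δ > 0. Then L = max_{{P_n}} liminf_{n→∞} √(n/δ) · I(P_n, W), where the maximum is over all sequences {P_n} of input distributions on X whose induced output distributions Q_n = P_n W on Y satisfy D(Q_n ‖ Q0) ≤ δ/n for every n. -/

import Mathlib

open Filter
open scoped BigOperators Topology

/-- `p` is a probability mass function on a finite type. -/
def IsDist {α : Type*} [Fintype α] (p : α → ℝ) : Prop :=
  (∀ a, 0 ≤ p a) ∧ ∑ a, p a = 1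

/-- Relative entropy (in nats) between pmfs on a finite type. -/
noncomputable def relEnt {α : Type*} [Fintype α] (p q : α → ℝ) : ℝ :=
  ∑ a, p a * Real.log (p a / q a)

/-- Output distribution on `Y` induced by input distribution `P` through channel `W`. -/
noncomputable def outDist {X Y : Type*} [Fintype X] (P : X → ℝ) (W : X → Y → ℝ) : Y → ℝ :=
  fun y => ∑ x, P x * W x y

/-- Mutual information `I(P, W)`. -/
noncomputable def mutInfo {X Y : Type*} [Fintype X] [Fintype Y] (P : X → ℝ) (W : X → Y → ℝ) : ℝ :=
  ∑ x, ∑ y, P x * W x y * Real.log (W x y / outDist P W y)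

/-- The output distribution on `Y^n` induced by a random code (a distribution `ρ` over
encoder/decoder pairs) together with a uniformly chosen message, through `n` memoryless
uses of the channel `W`. -/
noncomputable def codeOut {X Y : Type*} [Fintype X] [Fintype Y] [DecidableEq Y]
    (W : X → Y → ℝ) {n m : ℕ}
    (ρ : (Fin m → Fin n → X) × ((Fin n → Y) → Fin m) → ℝ) : (Fin n → Y) → ℝ :=
  fun ys => ∑ c, ρ c * ((m : ℝ)⁻¹ * ∑ j, ∏ i, W (c.1 j i) (ys i))

/-- Average probability of a decoding error of a random code, the message being uniform. -/
noncomputable def codeErr {X Y : Type*} [Fintype X] [Fintype Y] [DecidableEq Y]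
    (W : X → Y → ℝ) {n m : ℕ}
    (ρ : (Fin m → Fin n → X) × ((Fin n → Y) → Fin m) → ℝ) : ℝ :=
  ∑ c, ρ c * ((m : ℝ)⁻¹ * ∑ j, ∑ ys : Fin n → Y,
    if c.2 ys = j then 0 else ∏ i, W (c.1 j i) (ys i))

/-- `Kmax W x0 δ ε n` is the maximum of `log |M|` (in nats) over random codes of
blocklength `n` whose induced output distribution `Q^n` satisfies
`D(Q^n ‖ Q0^{×n}) ≤ δ` (with `Q0 = W(·|x0)`) and whose average error probability
is at most `ε`. -/
noncomputable def Kmax {X Y : Type*} [Fintype X] [Fintype Y] [DecidableEq Y]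
    (W : X → Y → ℝ) (x0 : X) (δ ε : ℝ) (n : ℕ) : ℝ :=
  sSup {k : ℝ | ∃ m : ℕ, 0 < m ∧
    ∃ ρ : (Fin m → Fin n → X) × ((Fin n → Y) → Fin m) → ℝ,
      (∀ c, 0 ≤ ρ c) ∧ (∑ c, ρ c) = 1 ∧
      relEnt (codeOut W ρ) (fun ys : Fin n → Y => ∏ i, W x0 (ys i)) ≤ δ ∧
      codeErr W ρ ≤ ε ∧ k = Real.log m}

/-- `IsL W x0 δ L` says that `L = lim_{ε↓0} liminf_{n→∞} K_n(δ,ε)/√(nδ)`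
(as an extended real, so that `L = ⊤` is allowed). -/
noncomputable def IsL {X Y : Type*} [Fintype X] [Fintype Y] [DecidableEq Y]
    (W : X → Y → ℝ) (x0 : X) (δ : ℝ) (L : EReal) : Prop :=
  Tendsto (fun ε : ℝ =>
      liminf (fun n : ℕ => ((Kmax W x0 δ ε n / Real.sqrt (n * δ) : ℝ) : EReal)) atTop)
    (nhdsWithin 0 (Set.Ioi 0)) (nhds L)


/-!
STATEMENT 1: For a DMC `W` with off symbol `x0`, `Q0 = W(·|x0)` of full support, and
`δ > 0`: `L = max_{{P_n}} liminf_{n→∞} √(n/δ) · I(P_n, W)`, the maximum being over all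
sequences of input distributions whose induced output distributions `Q_n = P_n W`
satisfy `D(Q_n ‖ Q0) ≤ δ/n` for every blocklength `n ≥ 1`.
-/

/-- The Donsker–Varadhan inequality for finite distributions. -/
theorem sum_mul_le_relEnt_add_log {ι : Type*} [Fintype ι] {A B : ι → ℝ} (hA : IsDist A)
    (hB : ∀ a, 0 ≤ B a) (hAB : ∀ a, 0 < A a → 0 < B a) (f : ι → ℝ) :
    ∑ a, A a * f a ≤ relEnt A B + Real.log (∑ a, B a * Real.exp (f a)) := by
  set Z := ∑ a, B a * Real.exp (f a) with hZ
  have hZpos : 0 < Z := by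
    obtain ⟨a, ha⟩ : ∃ a, 0 < A a := by
      by_contra! h
      have : ∑ a, A a ≤ 0 := Finset.sum_nonpos fun a _ => h a
      linarith [hA.2]
    exact Finset.sum_pos' (fun b _ => mul_nonneg (hB b) (Real.exp_pos _).le)
      ⟨a, Finset.mem_univ _, mul_pos (hAB a ha) (Real.exp_pos _)⟩
  have key : ∀ a, A a * f a - A a * Real.log (A a / B a) - A a * Real.log Z
      ≤ B a * Real.exp (f a) / Z - A a := by
    intro a
    rcases (hA.1 a).eq_or_lt with h | h
    · rw [← h]
      have := div_nonneg (mul_nonneg (hB a) (Real.exp_pos (f a)).le) hZpos.le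
      simpa using this
    · have hb := hAB a h
      have hr : 0 < B a * Real.exp (f a) / (Z * A a) := by positivity
      have h1 := Real.log_le_sub_one_of_pos hr
      have h2 : Real.log (B a * Real.exp (f a) / (Z * A a))
          = f a - Real.log (A a / B a) - Real.log Z := by
        rw [Real.log_div (by positivity) (by positivity), Real.log_mul hb.ne' (Real.exp_pos _).ne',
          Real.log_exp, Real.log_mul hZpos.ne' h.ne', Real.log_div h.ne' hb.ne']
        ring
      rw [h2] at h1
      have h3 := mul_le_mul_of_nonneg_left h1 h.le
      have h4 : A a * (B a * Real.exp (f a) / (Z * A a) - 1)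
          = B a * Real.exp (f a) / Z - A a := by
        field_simp
      rw [h4] at h3
      linarith
  have hs := Finset.sum_le_sum fun a (_ : a ∈ Finset.univ) => key a
  rw [Finset.sum_sub_distrib, Finset.sum_sub_distrib, Finset.sum_sub_distrib, ← Finset.sum_mul,
    ← Finset.sum_div, ← hZ, hA.2, div_self hZpos.ne'] at hs
  unfold relEnt
  linarith

theorem relEnt_nonneg {ι : Type*} [Fintype ι] {A B : ι → ℝ} (hA : IsDist A) (hB : IsDist B)
    (hAB : ∀ a, 0 < A a → 0 < B a) : 0 ≤ relEnt A B := by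
  have h := sum_mul_le_relEnt_add_log hA hB.1 hAB 0
  simpa [hB.2] using h

theorem sum_pi_prod {ι β : Type*} [Fintype ι] [DecidableEq ι] [Fintype β] (p : ι → β → ℝ) :
    ∑ f : ι → β, ∏ i, p i (f i) = ∏ i, ∑ b, p i b := by
  rw [Finset.prod_univ_sum, Fintype.piFinset_univ]

theorem isDist_pi {ι β : Type*} [Fintype ι] [DecidableEq ι] [Fintype β] {p : ι → β → ℝ}
    (hp : ∀ i, IsDist (p i)) : IsDist fun f : ι → β => ∏ i, p i (f i) :=
  ⟨fun f => Finset.prod_nonneg fun i _ => (hp i).1 _, by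
    rw [sum_pi_prod]; simp [(hp _).2]⟩

theorem sum_pi_prod_mul {ι β : Type*} [Fintype ι] [DecidableEq ι] [Fintype β] {p : ι → β → ℝ}
    (hp : ∀ i, IsDist (p i)) (k : ι) (u : β → ℝ) :
    ∑ f : ι → β, (∏ i, p i (f i)) * u (f k) = ∑ b, p k b * u b := by
  have h : ∀ f : ι → β, (∏ i, p i (f i)) * u (f k)
      = ∏ i, (p i (f i) * if i = k then u (f i) else 1) := by
    intro f
    rw [Finset.prod_mul_distrib, Finset.prod_ite_eq' Finset.univ k fun i => u (f i)]
    simp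
  simp_rw [h]
  rw [sum_pi_prod (fun i b => p i b * if i = k then u b else 1),
    ← Finset.mul_prod_erase _ _ (Finset.mem_univ k), Finset.prod_eq_one]
  · simp
  · intro i hi
    simp [Finset.ne_of_mem_erase hi, (hp i).2]

theorem sum_pi_prod_mul₂ {ι β : Type*} [Fintype ι] [DecidableEq ι] [Fintype β] {p : ι → β → ℝ}
    (hp : ∀ i, IsDist (p i)) {k l : ι} (hkl : k ≠ l) (u v : β → ℝ) :
    ∑ f : ι → β, (∏ i, p i (f i)) * (u (f k) * v (f l))
      = (∑ b, p k b * u b) * ∑ b, p l b * v b := by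
  have h : ∀ f : ι → β, (∏ i, p i (f i)) * (u (f k) * v (f l))
      = ∏ i, (p i (f i) * ((if i = k then u (f i) else 1) * if i = l then v (f i) else 1)) := by
    intro f
    rw [Finset.prod_mul_distrib, Finset.prod_mul_distrib,
      Finset.prod_ite_eq' Finset.univ k fun i => u (f i),
      Finset.prod_ite_eq' Finset.univ l fun i => v (f i)]
    simp
  simp_rw [h]
  rw [sum_pi_prod (fun i b => p i b * ((if i = k then u b else 1) * if i = l then v b else 1)),
    ← Finset.mul_prod_erase _ _ (Finset.mem_univ k),
    ← Finset.mul_prod_erase _ _ (Finset.mem_erase.2 ⟨hkl.symm, Finset.mem_univ l⟩),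
    Finset.prod_eq_one]
  · simp [hkl, hkl.symm]
  · intro i hi
    have h1 := Finset.ne_of_mem_erase hi
    have h2 := Finset.ne_of_mem_erase (Finset.mem_of_mem_erase hi)
    simp [h1, h2, (hp i).2]

theorem isDist_outDist {X Y : Type*} [Fintype X] [Fintype Y] {W : X → Y → ℝ}
    (hW : ∀ x, IsDist (W x)) {P : X → ℝ} (hP : IsDist P) : IsDist (outDist P W) := by
  refine ⟨fun y => Finset.sum_nonneg fun x _ => mul_nonneg (hP.1 x) ((hW x).1 y), ?_⟩
  unfold outDist
  rw [Finset.sum_comm]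
  simp_rw [← Finset.mul_sum, (hW _).2, mul_one, hP.2]

theorem outDist_pos {X Y : Type*} [Fintype X] [Fintype Y] {W : X → Y → ℝ}
    (hW : ∀ x, IsDist (W x)) {P : X → ℝ} (hP : IsDist P) {x : X} {y : Y} (hx : 0 < P x)
    (hy : 0 < W x y) : 0 < outDist P W y :=
  Finset.sum_pos' (fun x _ => mul_nonneg (hP.1 x) ((hW x).1 y))
    ⟨x, Finset.mem_univ _, mul_pos hx hy⟩

theorem prod_mul_log_div_prod {ι : Type*} [Fintype ι] {a b : ι → ℝ}
    (hb : ∀ i, a i ≠ 0 → b i ≠ 0) (t : ℝ) (ht : t ≠ 0 → ∏ i, a i ≠ 0) :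
    t * Real.log ((∏ i, a i) / ∏ i, b i) = ∑ i, t * Real.log (a i / b i) := by
  by_cases h : t = 0
  · simp [h]
  · have ha : ∀ i, a i ≠ 0 := fun i => Finset.prod_ne_zero_iff.1 (ht h) i (Finset.mem_univ i)
    rw [← Finset.prod_div_distrib, Real.log_prod fun i _ => div_ne_zero (ha i) (hb i (ha i)),
      Finset.mul_sum]

theorem relEnt_pi {Y : Type*} [Fintype Y] {Q q : Y → ℝ} (hQ : IsDist Q) (hq : ∀ y, 0 < q y)
    (n : ℕ) :
    relEnt (fun ys : Fin n → Y => ∏ i, Q (ys i)) (fun ys => ∏ i, q (ys i)) = n * relEnt Q q := by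
  unfold relEnt
  simp_rw [fun ys : Fin n → Y => prod_mul_log_div_prod (a := fun i => Q (ys i))
    (b := fun i => q (ys i)) (fun i _ => (hq _).ne') (∏ i, Q (ys i)) id]
  rw [Finset.sum_comm]
  simp_rw [fun i : Fin n => sum_pi_prod_mul (fun _ => hQ) i fun y => Real.log (Q y / q y)]
  simp

/-- The letter frequency of a weighted family of words. -/
theorem exists_isDist_average {S X : Type*} [Fintype S] [Fintype X] {n : ℕ} (hn : 0 < n)
    {w : S → ℝ} (hw : IsDist w) (xs : S → Fin n → X) :
    ∃ P : X → ℝ, IsDist P ∧ (∀ s i, 0 < w s → 0 < P (xs s i)) ∧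
      ∀ h : X → ℝ, n * ∑ x, P x * h x = ∑ s, w s * ∑ i, h (xs s i) := by
  classical
  have hn' : (0 : ℝ) < n := by exact_mod_cast hn
  let P : X → ℝ := fun x => (n : ℝ)⁻¹ * ∑ s, w s * ∑ i, if xs s i = x then 1 else 0
  have hP : ∀ h : X → ℝ, n * ∑ x, P x * h x = ∑ s, w s * ∑ i, h (xs s i) := by
    intro h
    simp only [P]
    simp_rw [mul_assoc, ← Finset.mul_sum]
    rw [← mul_assoc, mul_inv_cancel₀ hn'.ne', one_mul]
    simp_rw [Finset.sum_mul]
    rw [Finset.sum_comm]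
    refine Finset.sum_congr rfl fun s _ => ?_
    simp_rw [mul_assoc, ← Finset.mul_sum, Finset.sum_mul]
    rw [Finset.sum_comm]
    simp
  have hnn : ∀ s x, 0 ≤ w s * ∑ i, if xs s i = x then (1 : ℝ) else 0 := fun s x =>
    mul_nonneg (hw.1 s) (Finset.sum_nonneg fun i _ => by split_ifs <;> norm_num)
  refine ⟨P, ⟨fun x => mul_nonneg (by positivity) (Finset.sum_nonneg fun s _ => hnn s x), ?_⟩,
    fun s i hs => mul_pos (by positivity) (Finset.sum_pos' (fun s _ => hnn s _)
      ⟨s, Finset.mem_univ _, mul_pos hs (Finset.sum_pos' (fun i _ => by split_ifs <;> norm_num)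
        ⟨i, Finset.mem_univ _, by simp⟩)⟩), hP⟩
  have := hP fun _ => 1
  simp only [mul_one, Finset.sum_const, Finset.card_univ, Fintype.card_fin, nsmul_eq_mul,
    ← Finset.sum_mul, hw.2, one_mul] at this
  exact (mul_right_eq_self₀.1 this).resolve_right hn'.ne'

section Converse

variable {X Y S : Type*} [Fintype Y] [Fintype S] {W : X → Y → ℝ} {n : ℕ}
  {w : S → ℝ} {xs : S → Fin n → X} {P : X → ℝ}

theorem isDist_joint (hW : ∀ x, IsDist (W x)) (hw : IsDist w) :
    IsDist fun a : S × (Fin n → Y) => w a.1 * ∏ i, W (xs a.1 i) (a.2 i) := by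
  refine ⟨fun a => mul_nonneg (hw.1 _) (Finset.prod_nonneg fun i _ => (hW _).1 _), ?_⟩
  rw [Fintype.sum_prod_type]
  simp_rw [← Finset.mul_sum, fun s : S => (isDist_pi fun i => hW (xs s i)).2, mul_one, hw.2]

theorem isDist_mixture (hW : ∀ x, IsDist (W x)) (hw : IsDist w) :
    IsDist fun ys : Fin n → Y => ∑ s, w s * ∏ i, W (xs s i) (ys i) := by
  refine ⟨fun ys => Finset.sum_nonneg fun s _ =>
    mul_nonneg (hw.1 _) (Finset.prod_nonneg fun i _ => (hW _).1 _), ?_⟩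
  rw [← (isDist_joint (xs := xs) hW hw).2, Fintype.sum_prod_type_right]

variable [Fintype X]

theorem mixture_pos_imp (hW : ∀ x, IsDist (W x)) (hP : IsDist P) (hw : IsDist w)
    (hpos : ∀ s i, 0 < w s → 0 < P (xs s i)) (ys : Fin n → Y)
    (h : 0 < ∑ s, w s * ∏ i, W (xs s i) (ys i)) : 0 < ∏ i, outDist P W (ys i) := by
  obtain ⟨s, -, hs⟩ := Finset.exists_ne_zero_of_sum_ne_zero h.ne'
  have hws := (hw.1 s).lt_of_ne' (left_ne_zero_of_mul hs)
  refine Finset.prod_pos fun i _ => outDist_pos hW hP (hpos s i hws) (((hW _).1 _).lt_of_ne' ?_)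
  exact Finset.prod_ne_zero_iff.1 (right_ne_zero_of_mul hs) i (Finset.mem_univ i)

theorem sum_mixture_mul (hW : ∀ x, IsDist (W x))
    (hsum : ∀ h : X → ℝ, n * ∑ x, P x * h x = ∑ s, w s * ∑ i, h (xs s i)) (u : Y → ℝ) :
    ∑ ys : Fin n → Y, (∑ s, w s * ∏ i, W (xs s i) (ys i)) * ∑ i, u (ys i)
      = n * ∑ y, outDist P W y * u y := by
  have h := hsum fun x => ∑ y, W x y * u y
  have h1 : ∑ y, outDist P W y * u y = ∑ x, P x * ∑ y, W x y * u y := by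
    simp_rw [outDist, Finset.sum_mul, Finset.mul_sum, mul_assoc]
    exact Finset.sum_comm
  rw [h1, h]
  simp_rw [Finset.sum_mul]
  rw [Finset.sum_comm]
  refine Finset.sum_congr rfl fun s _ => ?_
  simp_rw [mul_assoc, ← Finset.mul_sum]
  congr 1
  simp_rw [Finset.mul_sum]
  rw [Finset.sum_comm]
  exact Finset.sum_congr rfl fun i _ => sum_pi_prod_mul (fun i => hW (xs s i)) i u

/-- The average letter distribution of a code has an output closer to `q` per letter. -/
theorem mul_relEnt_outDist_le (hW : ∀ x, IsDist (W x)) (hP : IsDist P) (hw : IsDist w)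
    (hpos : ∀ s i, 0 < w s → 0 < P (xs s i))
    (hsum : ∀ h : X → ℝ, n * ∑ x, P x * h x = ∑ s, w s * ∑ i, h (xs s i))
    {q : Y → ℝ} (hq : ∀ y, 0 < q y) :
    n * relEnt (outDist P W) q ≤
      relEnt (fun ys : Fin n → Y => ∑ s, w s * ∏ i, W (xs s i) (ys i))
        fun ys => ∏ i, q (ys i) := by
  have hQ := isDist_mixture (xs := xs) hW hw
  have h0 := relEnt_nonneg hQ (isDist_pi fun _ : Fin n => isDist_outDist hW hP)
    (mixture_pos_imp hW hP hw hpos)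
  have h1 := sum_mixture_mul (P := P) hW hsum fun y => Real.log (outDist P W y / q y)
  refine le_of_eq_of_le (b := relEnt (fun ys : Fin n → Y => ∑ s, w s * ∏ i, W (xs s i) (ys i))
        (fun ys => ∏ i, q (ys i)) - relEnt (fun ys : Fin n → Y => ∑ s, w s * ∏ i, W (xs s i) (ys i))
        (fun ys => ∏ i, outDist P W (ys i))) ?_ (by linarith)
  unfold relEnt at *
  rw [← h1, ← Finset.sum_sub_distrib]
  refine Finset.sum_congr rfl fun ys _ => ?_
  rcases (hQ.1 ys).eq_or_lt with h | h
  · simp only at h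
    simp [← h]
  · have h2 := mixture_pos_imp hW hP hw hpos ys h
    have h3 : ∏ i, q (ys i) ≠ 0 := (Finset.prod_pos fun i _ => hq _).ne'
    have h4 := prod_mul_log_div_prod (a := fun i => outDist P W (ys i)) (b := fun i => q (ys i))
      (fun i _ => (hq _).ne') 1 fun _ => h2.ne'
    simp only [one_mul] at h4
    rw [← h4, ← mul_sub, Real.log_div h2.ne' h3, Real.log_div h.ne' h3, Real.log_div h.ne' h2.ne']
    ring

theorem relEnt_joint_eq (hW : ∀ x, IsDist (W x)) (hP : IsDist P) (hw : IsDist w)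
    (hpos : ∀ s i, 0 < w s → 0 < P (xs s i))
    (hsum : ∀ h : X → ℝ, n * ∑ x, P x * h x = ∑ s, w s * ∑ i, h (xs s i)) :
    relEnt (fun a : S × (Fin n → Y) => w a.1 * ∏ i, W (xs a.1 i) (a.2 i))
      (fun a => w a.1 * ∏ i, outDist P W (a.2 i)) = n * mutInfo P W := by
  have h := hsum fun x => ∑ y, W x y * Real.log (W x y / outDist P W y)
  have h1 : mutInfo P W = ∑ x, P x * ∑ y, W x y * Real.log (W x y / outDist P W y) := by
    simp_rw [mutInfo, Finset.mul_sum, mul_assoc]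
  rw [h1, h, relEnt, Fintype.sum_prod_type]
  refine Finset.sum_congr rfl fun s _ => ?_
  simp only
  rcases (hw.1 s).eq_or_lt with hs | hs
  · simp [← hs]
  simp_rw [mul_div_mul_left _ _ hs.ne', mul_assoc]
  rw [← Finset.mul_sum]
  congr 1
  simp_rw [fun ys : Fin n → Y => prod_mul_log_div_prod (a := fun i => W (xs s i) (ys i))
    (b := fun i => outDist P W (ys i)) (fun i hi => (outDist_pos hW hP (hpos s i hs)
      (((hW _).1 _).lt_of_ne' hi)).ne') (∏ i, W (xs s i) (ys i)) id]
  rw [Finset.sum_comm]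
  exact Finset.sum_congr rfl fun i _ => sum_pi_prod_mul (fun i => hW (xs s i)) i
    fun y => Real.log (W (xs s i) y / outDist P W y)

end Converse

/-- Weak converse: a code meeting the output constraint induces an input letter distribution
meeting the per-letter constraint and carrying the rate of the code. -/
theorem exists_isDist_of_code {X Y : Type*} [Fintype X] [Fintype Y] [DecidableEq Y]
    {W : X → Y → ℝ} (hW : ∀ x, IsDist (W x)) {q : Y → ℝ} (hq : ∀ y, 0 < q y)
    {n m : ℕ} (hn : 0 < n) (hm : 0 < m)
    {ρ : (Fin m → Fin n → X) × ((Fin n → Y) → Fin m) → ℝ} (hρ : IsDist ρ) :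
    ∃ P : X → ℝ, IsDist P ∧
      n * relEnt (outDist P W) q ≤ relEnt (codeOut W ρ) (fun ys : Fin n → Y => ∏ i, q (ys i)) ∧
      (1 - codeErr W ρ) * Real.log m ≤ n * mutInfo P W + Real.log 2 := by
  have hm' : (0 : ℝ) < m := by exact_mod_cast hm
  let S := ((Fin m → Fin n → X) × ((Fin n → Y) → Fin m)) × Fin m
  let w : S → ℝ := fun s => ρ s.1 * (m : ℝ)⁻¹
  let xs : S → Fin n → X := fun s => s.1.1 s.2
  have hw : IsDist w := by
    refine ⟨fun s => mul_nonneg (hρ.1 _) (by positivity), ?_⟩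
    rw [Fintype.sum_prod_type]
    refine Eq.trans (Finset.sum_congr rfl fun c _ => ?_) hρ.2
    simp only [w, Finset.sum_const, Finset.card_univ, Fintype.card_fin, nsmul_eq_mul]
    field_simp
  obtain ⟨P, hP, hpos, hsum⟩ := exists_isDist_average hn hw xs
  refine ⟨P, hP, ?_, ?_⟩
  · convert mul_relEnt_outDist_le hW hP hw hpos hsum hq using 2
    funext ys
    simp only [codeOut, Fintype.sum_prod_type (α₁ := (Fin m → Fin n → X) × ((Fin n → Y) → Fin m)),
      S, w, xs, Finset.mul_sum, mul_assoc]
  · have hA := isDist_joint (xs := xs) hW hw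
    have hB : ∀ a : S × (Fin n → Y), 0 ≤ w a.1 * ∏ i, outDist P W (a.2 i) := fun a =>
      mul_nonneg (hw.1 _) (Finset.prod_nonneg fun i _ => (isDist_outDist hW hP).1 _)
    have hAB : ∀ a : S × (Fin n → Y), 0 < w a.1 * ∏ i, W (xs a.1 i) (a.2 i) →
        0 < w a.1 * ∏ i, outDist P W (a.2 i) := by
      intro a ha
      have hws := (hw.1 a.1).lt_of_ne' (left_ne_zero_of_mul ha.ne')
      refine mul_pos hws (Finset.prod_pos fun i _ => outDist_pos hW hP (hpos _ i hws)
        (((hW _).1 _).lt_of_ne' ?_))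
      exact Finset.prod_ne_zero_iff.1 (right_ne_zero_of_mul ha.ne') i (Finset.mem_univ i)
    have h := sum_mul_le_relEnt_add_log hA hB hAB
      fun a => if a.1.1.2 a.2 = a.1.2 then Real.log m else 0
    rw [relEnt_joint_eq hW hP hw hpos hsum] at h
    have h1 : ∑ a : S × (Fin n → Y), w a.1 * (∏ i, W (xs a.1 i) (a.2 i)) *
        (if a.1.1.2 a.2 = a.1.2 then Real.log m else 0) = (1 - codeErr W ρ) * Real.log m := by
      have e1 : codeErr W ρ = ∑ a : S × (Fin n → Y), w a.1 * (∏ i, W (xs a.1 i) (a.2 i)) *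
        (if a.1.1.2 a.2 = a.1.2 then 0 else 1) := by
        rw [Fintype.sum_prod_type, Fintype.sum_prod_type]
        simp only [codeErr, w, xs, Finset.mul_sum, mul_assoc, mul_ite, mul_one, mul_zero]
      have e2 : 1 - codeErr W ρ = ∑ a : S × (Fin n → Y), w a.1 * (∏ i, W (xs a.1 i) (a.2 i)) *
          (if a.1.1.2 a.2 = a.1.2 then 1 else 0) := by
        rw [e1, sub_eq_iff_eq_add, ← Finset.sum_add_distrib]
        refine hA.2.symm.trans (Finset.sum_congr rfl fun a _ => ?_)
        split_ifs <;> simp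
      rw [e2, Finset.sum_mul]
      refine Finset.sum_congr rfl fun a _ => ?_
      split_ifs <;> simp
    have h2 : ∑ a : S × (Fin n → Y), w a.1 * (∏ i, outDist P W (a.2 i)) *
        Real.exp (if a.1.1.2 a.2 = a.1.2 then Real.log m else 0) ≤ 2 := by
      have hQn := isDist_pi fun _ : Fin n => isDist_outDist hW hP
      calc _ ≤ ∑ a : S × (Fin n → Y), (w a.1 * (∏ i, outDist P W (a.2 i)) +
            ρ a.1.1 * ((∏ i, outDist P W (a.2 i)) * if a.1.1.2 a.2 = a.1.2 then 1 else 0)) := by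
            refine Finset.sum_le_sum fun a _ => ?_
            have := hB a
            split_ifs
            · rw [Real.exp_log hm']
              have e : w a.1 * (∏ i, outDist P W (a.2 i)) * m
                  = ρ a.1.1 * ((∏ i, outDist P W (a.2 i)) * 1) := by
                simp only [w]; field_simp
              linarith
            · simp
        _ = 1 + 1 := by
            rw [Finset.sum_add_distrib]
            congr 1
            · rw [Fintype.sum_prod_type]
              simp_rw [← Finset.mul_sum, hQn.2, mul_one, hw.2]
            · rw [Fintype.sum_prod_type_right]
              refine Eq.trans (Finset.sum_congr rfl fun ys _ => ?_) hQn.2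
              rw [Fintype.sum_prod_type]
              simp [← Finset.sum_mul, hρ.2]
        _ = 2 := by norm_num
    rw [h1] at h
    have h3 : Real.log (∑ a : S × (Fin n → Y), w a.1 * (∏ i, outDist P W (a.2 i)) *
        Real.exp (if a.1.1.2 a.2 = a.1.2 then Real.log m else 0)) ≤ Real.log 2 := by
      refine Real.log_le_log (Finset.sum_pos' (fun a _ => mul_nonneg (hB a) (Real.exp_pos _).le) ?_)
        h2
      obtain ⟨a, -, ha⟩ := Finset.exists_ne_zero_of_sum_ne_zero
        (ne_of_eq_of_ne hA.2 one_ne_zero)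
      exact ⟨a, Finset.mem_univ _, mul_pos (hAB a ((hA.1 a).lt_of_ne' ha)) (Real.exp_pos _)⟩
    linarith

theorem sqrt_sub_sqrt_sq_le {a b : ℝ} (ha : 0 ≤ a) (hb : 0 < b) :
    (√a - √b) ^ 2 ≤ a * Real.log (a / b) - a + b := by
  rcases ha.eq_or_lt with rfl | ha'
  · simp [Real.sq_sqrt hb.le]
  · have hs := Real.sqrt_pos.2 ha'
    have hr := Real.sqrt_pos.2 hb
    have h1 := Real.one_sub_inv_le_log_of_pos (div_pos hs hr)
    have h2 : Real.log (a / b) = 2 * Real.log (√a / √b) := by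
      rw [← Real.sqrt_div ha, Real.log_sqrt (div_nonneg ha hb.le)]; ring
    rw [inv_div] at h1
    have h3 := mul_le_mul_of_nonneg_left h1 ha
    have h4 : a * (1 - √b / √a) = a - √a * √b := by
      rw [mul_sub, mul_one, mul_div_assoc', sub_right_inj, div_eq_iff hs.ne']
      nlinarith [Real.mul_self_sqrt ha]
    rw [h2]
    nlinarith [Real.sq_sqrt ha, Real.sq_sqrt hb.le]

theorem mul_log_sq_le {a b T : ℝ} (ha : 0 ≤ a) (hb : 0 < b) (hT : 1 ≤ T) (hab : a ≤ T * b) :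
    a * Real.log (a / b) ^ 2 ≤ 4 * T * (a * Real.log (a / b) - a + b) := by
  refine le_trans ?_ (mul_le_mul_of_nonneg_left (sqrt_sub_sqrt_sq_le ha hb) (by positivity))
  rcases ha.eq_or_lt with rfl | ha'
  · rw [zero_mul]; positivity
  have hs := Real.sqrt_pos.2 ha'
  have hr := Real.sqrt_pos.2 hb
  have h2 : Real.log (a / b) = 2 * Real.log (√a / √b) := by
    rw [← Real.sqrt_div ha, Real.log_sqrt (div_nonneg ha hb.le)]; ring
  have hl := Real.one_sub_inv_le_log_of_pos (div_pos hs hr)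
  have hu := Real.log_le_sub_one_of_pos (div_pos hs hr)
  rw [inv_div] at hl
  suffices h : (√a * Real.log (√a / √b)) ^ 2 ≤ T * (√a - √b) ^ 2 by
    rw [h2]
    rw [mul_pow, Real.sq_sqrt ha] at h
    nlinarith
  rcases le_total (√b) (√a) with h | h
  · have h0 : 0 ≤ Real.log (√a / √b) := Real.log_nonneg ((one_le_div hr).2 h)
    have h3 : √a * Real.log (√a / √b) ≤ √a / √b * (√a - √b) := by
      calc _ ≤ √a * (√a / √b - 1) := mul_le_mul_of_nonneg_left hu hs.le
        _ = _ := by field_simp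
    refine (pow_le_pow_left₀ (mul_nonneg hs.le h0) h3 2).trans ?_
    rw [mul_pow, div_pow, Real.sq_sqrt ha, Real.sq_sqrt hb.le]
    exact mul_le_mul_of_nonneg_right ((div_le_iff₀ hb).2 hab) (sq_nonneg _)
  · have h0 : Real.log (√a / √b) ≤ 0 :=
      Real.log_nonpos (div_pos hs hr).le ((div_le_one hr).2 h)
    have h3 : √a - √b ≤ √a * Real.log (√a / √b) := by
      calc _ = √a * (1 - √b / √a) := by field_simp
        _ ≤ _ := mul_le_mul_of_nonneg_left hl hs.le
    have h5 := mul_nonpos_of_nonneg_of_nonpos hs.le h0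
    have h4 : (√a * Real.log (√a / √b)) ^ 2 ≤ (√a - √b) ^ 2 := by nlinarith
    exact h4.trans (le_mul_of_one_le_left (sq_nonneg _) hT)

theorem sqrt_sub_sqrt_sq_le_relEnt {Y : Type*} [Fintype Y] {Q q : Y → ℝ} (hQ : IsDist Q)
    (hq : IsDist q) (hpos : ∀ y, 0 < q y) (y : Y) : (√(Q y) - √(q y)) ^ 2 ≤ relEnt Q q := by
  have h : ∑ y, (Q y * Real.log (Q y / q y) - Q y + q y) = relEnt Q q := by
    rw [Finset.sum_add_distrib, Finset.sum_sub_distrib, hQ.2, hq.2]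
    unfold relEnt; ring
  rw [← h]
  refine (sqrt_sub_sqrt_sq_le (hQ.1 y) (hpos y)).trans (Finset.single_le_sum
    (f := fun y => Q y * Real.log (Q y / q y) - Q y + q y) (fun z _ => ?_) (Finset.mem_univ y))
  exact (sq_nonneg _).trans (sqrt_sub_sqrt_sq_le (hQ.1 z) (hpos z))

theorem div_four_le_of_relEnt_le {Y : Type*} [Fintype Y] {Q q : Y → ℝ} (hQ : IsDist Q)
    (hq : IsDist q) (hpos : ∀ y, 0 < q y) (y : Y) (h : relEnt Q q ≤ q y / 4) :
    q y / 4 ≤ Q y := by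
  have h1 := (sqrt_sub_sqrt_sq_le_relEnt hQ hq hpos y).trans h
  have hs := Real.sqrt_pos.2 (hpos y)
  have h2 : √(q y) / 2 ≤ √(Q y) := by
    have h3 : (√(q y) - √(Q y)) ^ 2 ≤ (√(q y) / 2) ^ 2 := by
      rw [div_pow, Real.sq_sqrt (hpos y).le]; nlinarith
    have := abs_le_of_sq_le_sq h3 (by positivity)
    linarith [le_abs_self (√(q y) - √(Q y))]
  have h4 := pow_le_pow_left₀ (by positivity) h2 2
  rw [div_pow, Real.sq_sqrt (hpos y).le, Real.sq_sqrt (hQ.1 y)] at h4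
  linarith

/-- The second moment of the information density is controlled by its mean. -/
theorem sum_mul_log_sq_le {X Y : Type*} [Fintype X] [Fintype Y] {W : X → Y → ℝ}
    (hW : ∀ x, IsDist (W x)) {P : X → ℝ} (hP : IsDist P) (hQ : ∀ y, 0 < outDist P W y) {T : ℝ}
    (hT : 1 ≤ T) (h : ∀ x y, W x y ≤ T * outDist P W y) :
    ∑ x, ∑ y, P x * W x y * Real.log (W x y / outDist P W y) ^ 2 ≤ 4 * T * mutInfo P W := by
  unfold mutInfo
  rw [Finset.mul_sum]
  refine Finset.sum_le_sum fun x _ => ?_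
  simp_rw [mul_assoc, ← Finset.mul_sum]
  have h1 := Finset.sum_le_sum fun y (_ : y ∈ Finset.univ) =>
    mul_log_sq_le ((hW x).1 y) (hQ y) hT (h x y)
  rw [← Finset.mul_sum, Finset.sum_add_distrib, Finset.sum_sub_distrib, (hW x).2,
    (isDist_outDist hW hP).2] at h1
  nlinarith [mul_le_mul_of_nonneg_left h1 (hP.1 x)]

/-- Shannon's one-shot achievability bound for independent random codewords. -/
theorem exists_decoder_sum_le {β η : Type*} [Fintype β] [Fintype η] {V : β → η → ℝ}
    (hV : ∀ b, IsDist (V b)) {p : β → ℝ} (hp : IsDist p) {m : ℕ} (hm : 0 < m) {γ : ℝ}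
    (hγ : 0 < γ) :
    ∃ dec : (Fin m → β) → η → Fin m,
      ∑ f : Fin m → β, (∏ j, p (f j)) *
        ((m : ℝ)⁻¹ * ∑ j, ∑ y, if dec f y = j then 0 else V (f j) y) ≤
      (∑ b, ∑ y, if V b y ≤ γ * outDist p V y then p b * V b y else 0) + m / γ := by
  classical
  have hm' : (0 : ℝ) < m := by exact_mod_cast hm
  set Q := outDist p V with hQdef
  let dec : (Fin m → β) → η → Fin m := fun f y =>
    if h : ∃ k, γ * Q y < V (f k) y then h.choose else ⟨0, hm⟩
  refine ⟨dec, ?_⟩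
  set A := ∑ b, ∑ y, if V b y ≤ γ * Q y then p b * V b y else 0 with hA
  have hdec : ∀ f j y, (if dec f y = j then 0 else V (f j) y) ≤
      (if V (f j) y ≤ γ * Q y then V (f j) y else 0) +
        ∑ k, if k ≠ j then V (f j) y * (if γ * Q y < V (f k) y then 1 else 0) else 0 := by
    intro f j y
    have hnn := (hV (f j)).1 y
    have hk : ∀ k ∈ Finset.univ, 0 ≤ if k ≠ j then
        V (f j) y * (if γ * Q y < V (f k) y then (1 : ℝ) else 0) else 0 := fun k _ => by
      split_ifs <;> simp [hnn]
    by_cases h : dec f y = j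
    · rw [if_pos h]
      exact add_nonneg (by split_ifs <;> simp [hnn]) (Finset.sum_nonneg hk)
    · rw [if_neg h]
      by_cases hj : V (f j) y ≤ γ * Q y
      · rw [if_pos hj]
        linarith [Finset.sum_nonneg hk]
      · rw [if_neg hj, zero_add]
        have hex : ∃ k, γ * Q y < V (f k) y := ⟨j, not_le.1 hj⟩
        have hd : γ * Q y < V (f (dec f y)) y := by
          simp only [dec, dif_pos hex]
          exact hex.choose_spec
        refine le_trans ?_ (Finset.single_le_sum hk (Finset.mem_univ (dec f y)))
        simp [h, hd]
  have hpf : ∀ f : Fin m → β, 0 ≤ ∏ j, p (f j) := fun f => Finset.prod_nonneg fun j _ => hp.1 _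
  have hpair : ∀ j k : Fin m, k ≠ j →
      ∑ f : Fin m → β, (∏ j, p (f j)) *
        ∑ y, V (f j) y * (if γ * Q y < V (f k) y then 1 else 0) ≤ γ⁻¹ := by
    intro j k hkj
    simp_rw [Finset.mul_sum]
    rw [Finset.sum_comm]
    simp_rw [fun y => sum_pi_prod_mul₂ (p := fun _ : Fin m => p) (fun _ => hp) hkj.symm
      (fun b => V b y) fun b => if γ * Q y < V b y then (1 : ℝ) else 0]
    refine le_trans (b := ∑ y, γ⁻¹ * Q y) (Finset.sum_le_sum fun y _ => ?_) (le_of_eq ?_)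
    · change Q y * _ ≤ _
      have hQy : γ⁻¹ * Q y = ∑ b, γ⁻¹ * (p b * V b y) := Finset.mul_sum ..
      rw [Finset.mul_sum, hQy]
      refine Finset.sum_le_sum fun b _ => ?_
      have h1 : 0 ≤ p b * V b y := mul_nonneg (hp.1 b) ((hV b).1 y)
      split_ifs with hlt
      · have h2 := mul_le_mul_of_nonneg_left hlt.le (hp.1 b)
        rw [inv_mul_eq_div, le_div_iff₀ hγ]
        linarith
      · rw [mul_zero, mul_zero]; positivity
    · rw [← Finset.mul_sum, (isDist_outDist hV hp).2, mul_one]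
  have hj : ∀ j, ∑ f : Fin m → β, (∏ j, p (f j)) * ∑ y, (if dec f y = j then 0 else V (f j) y)
      ≤ A + m / γ := by
    intro j
    calc _ ≤ ∑ f : Fin m → β, ((∏ j, p (f j)) * (∑ y, if V (f j) y ≤ γ * Q y then V (f j) y else 0)
            + ∑ k, if k ≠ j then (∏ j, p (f j)) *
              ∑ y, V (f j) y * (if γ * Q y < V (f k) y then 1 else 0) else 0) := by
          refine Finset.sum_le_sum fun f _ => ?_
          refine (mul_le_mul_of_nonneg_left (Finset.sum_le_sum fun y _ => hdec f j y)
            (hpf f)).trans_eq ?_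
          rw [Finset.sum_add_distrib, mul_add, Finset.sum_comm (t := (Finset.univ : Finset (Fin m)))]
          congr 1
          rw [Finset.mul_sum]
          refine Finset.sum_congr rfl fun k _ => ?_
          split_ifs <;> simp
      _ ≤ A + ∑ k : Fin m, γ⁻¹ := by
          rw [Finset.sum_add_distrib]
          refine add_le_add (le_of_eq ?_) ?_
          · rw [sum_pi_prod_mul (p := fun _ : Fin m => p) (fun _ => hp) j
              fun b => ∑ y, if V b y ≤ γ * Q y then V b y else 0]
            simp only [hA, Finset.mul_sum, mul_ite, mul_zero]
          · rw [Finset.sum_comm]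
            refine Finset.sum_le_sum fun k _ => ?_
            by_cases h : k = j
            · simp [h, hγ.le]
            · simpa [h] using hpair j k h
      _ = A + m / γ := by simp [div_eq_mul_inv]
  calc _ = (m : ℝ)⁻¹ * ∑ j, ∑ f : Fin m → β, (∏ j, p (f j)) *
        ∑ y, (if dec f y = j then 0 else V (f j) y) := by
        rw [Finset.sum_comm, Finset.mul_sum]
        refine Finset.sum_congr rfl fun f _ => ?_
        rw [← Finset.mul_sum]; ring
    _ ≤ (m : ℝ)⁻¹ * ∑ _j : Fin m, (A + m / γ) :=
        mul_le_mul_of_nonneg_left (Finset.sum_le_sum fun j _ => hj j) (by positivity)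
    _ = A + m / γ := by simp only [Finset.sum_const, Finset.card_univ, Fintype.card_fin,
          nsmul_eq_mul]; field_simp

/-- The variance of a sum of independent copies is at most the sum of second moments. -/
theorem sum_pi_prod_mul_sub_sq_le {Z : Type*} [Fintype Z] {R : Z → ℝ} (hR : IsDist R)
    (h : Z → ℝ) (n : ℕ) :
    ∑ z : Fin n → Z, (∏ i, R (z i)) * (∑ i, h (z i) - n * ∑ b, R b * h b) ^ 2
      ≤ n * ∑ b, R b * h b ^ 2 := by
  set μ := ∑ b, R b * h b with hμ
  have h0 : ∑ b, R b * (h b - μ) = 0 := by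
    simp_rw [mul_sub]
    rw [Finset.sum_sub_distrib, ← Finset.sum_mul, hR.2, ← hμ]; ring
  have h1 : ∑ b, R b * ((h b - μ) * (h b - μ)) ≤ ∑ b, R b * h b ^ 2 := by
    have : ∑ b, R b * ((h b - μ) * (h b - μ)) = ∑ b, R b * h b ^ 2 - μ ^ 2 := by
      calc _ = ∑ b, (R b * h b ^ 2 - 2 * μ * (R b * h b) + μ ^ 2 * R b) :=
            Finset.sum_congr rfl fun b _ => by ring
        _ = _ := by
            rw [Finset.sum_add_distrib, Finset.sum_sub_distrib, ← Finset.mul_sum,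
              ← Finset.mul_sum, hR.2, ← hμ]; ring
    rw [this]; nlinarith [sq_nonneg μ]
  have h2 : ∀ z : Fin n → Z, (∏ i, R (z i)) * (∑ i, h (z i) - n * μ) ^ 2
      = ∑ i, ∑ k, (∏ i, R (z i)) * ((h (z i) - μ) * (h (z k) - μ)) := by
    intro z
    have : ∑ i, h (z i) - n * μ = ∑ i, (h (z i) - μ) := by simp
    rw [this, sq, Finset.sum_mul_sum, Finset.mul_sum]
    simp_rw [Finset.mul_sum]
  simp_rw [h2]
  rw [Finset.sum_comm]
  calc _ = ∑ i : Fin n, ∑ b, R b * ((h b - μ) * (h b - μ)) := by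
        refine Finset.sum_congr rfl fun i _ => ?_
        rw [Finset.sum_comm, Finset.sum_eq_single i]
        · exact sum_pi_prod_mul (p := fun _ : Fin n => R) (fun _ => hR) i
            fun b => (h b - μ) * (h b - μ)
        · intro k _ hk
          rw [sum_pi_prod_mul₂ (p := fun _ : Fin n => R) (fun _ => hR) hk.symm
            (fun b => h b - μ) fun b => h b - μ, h0, zero_mul]
        · simp
    _ ≤ ∑ i : Fin n, ∑ b, R b * h b ^ 2 := Finset.sum_le_sum fun i _ => h1
    _ = _ := by simp

theorem outDist_pi {X Y : Type*} [Fintype X] [Fintype Y] (P : X → ℝ) (W : X → Y → ℝ) (n : ℕ) :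
    outDist (fun xs : Fin n → X => ∏ i, P (xs i)) (fun xs ys => ∏ i, W (xs i) (ys i))
      = fun ys : Fin n → Y => ∏ i, outDist P W (ys i) := by
  funext ys
  unfold outDist
  simp_rw [← Finset.prod_mul_distrib]
  exact sum_pi_prod fun i x => P x * W x (ys i)

/-- Chebyshev bound for the lower tail of the information density of a memoryless block. -/
theorem sum_infoDensity_tail_le {X Y : Type*} [Fintype X] [Fintype Y] {W : X → Y → ℝ}
    (hW : ∀ x, IsDist (W x)) {P : X → ℝ} (hP : IsDist P) (n : ℕ) {g : ℝ}
    (hg : g < n * mutInfo P W) :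
    (∑ xs : Fin n → X, ∑ ys : Fin n → Y,
      if ∏ i, W (xs i) (ys i) ≤ Real.exp g * ∏ i, outDist P W (ys i) then
        (∏ i, P (xs i)) * ∏ i, W (xs i) (ys i) else 0) ≤
      n * (∑ x, ∑ y, P x * W x y * Real.log (W x y / outDist P W y) ^ 2) /
        (n * mutInfo P W - g) ^ 2 := by
  have hd : 0 < n * mutInfo P W - g := sub_pos.2 hg
  rw [le_div_iff₀ (by positivity)]
  let R : X × Y → ℝ := fun z => P z.1 * W z.1 z.2
  let h : X × Y → ℝ := fun z => Real.log (W z.1 z.2 / outDist P W z.2)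
  have hR : IsDist R := by
    refine ⟨fun z => mul_nonneg (hP.1 _) ((hW _).1 _), ?_⟩
    rw [Fintype.sum_prod_type]
    simp only [R]
    simp_rw [← Finset.mul_sum, (hW _).2, mul_one, hP.2]
  have hI : ∑ z, R z * h z = mutInfo P W := Fintype.sum_prod_type _
  have hI2 : ∑ z, R z * h z ^ 2
      = ∑ x, ∑ y, P x * W x y * Real.log (W x y / outDist P W y) ^ 2 := Fintype.sum_prod_type _
  have key := sum_pi_prod_mul_sub_sq_le hR h n
  rw [hI, hI2] at key
  refine le_trans ?_ key
  rw [← Fintype.sum_prod_type', ← (Equiv.arrowProdEquivProdArrow (Fin n) (fun _ => X)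
    (fun _ => Y)).sum_comp, Finset.sum_mul]
  refine Finset.sum_le_sum fun z _ => ?_
  simp only [Equiv.arrowProdEquivProdArrow_apply]
  rw [← Finset.prod_mul_distrib]
  change (if _ then ∏ i, R (z i) else 0) * _ ≤ _
  have hRz : 0 ≤ ∏ i, R (z i) := Finset.prod_nonneg fun i _ => hR.1 _
  split_ifs with hle
  · rcases hRz.eq_or_lt with h0 | h0
    · simp [← h0]
    refine mul_le_mul_of_nonneg_left ?_ h0.le
    have hRi : ∀ i, R (z i) ≠ 0 := fun i => Finset.prod_ne_zero_iff.1 h0.ne' i (Finset.mem_univ i)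
    have hWi : ∀ i, 0 < W (z i).1 (z i).2 := fun i =>
      ((hW _).1 _).lt_of_ne' (right_ne_zero_of_mul (hRi i))
    have hQi : ∀ i, 0 < outDist P W (z i).2 := fun i =>
      outDist_pos hW hP ((hP.1 _).lt_of_ne' (left_ne_zero_of_mul (hRi i))) (hWi i)
    have hsum : ∑ i, h (z i) ≤ g := by
      simp only [h]
      rw [← Real.log_prod fun i _ => (div_pos (hWi i) (hQi i)).ne', Finset.prod_div_distrib,
        Real.log_le_iff_le_exp (div_pos (Finset.prod_pos fun i _ => hWi i)
          (Finset.prod_pos fun i _ => hQi i)), div_le_iff₀ (Finset.prod_pos fun i _ => hQi i)]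
      exact hle
    nlinarith
  · rw [zero_mul]; positivity

theorem exists_random_code {X Y : Type*} [Fintype X] [Fintype Y] [DecidableEq Y] {W : X → Y → ℝ}
    (hW : ∀ x, IsDist (W x)) {P : X → ℝ} (hP : IsDist P) (n : ℕ) {m : ℕ} (hm : 0 < m) {g : ℝ}
    (hg : g < n * mutInfo P W) :
    ∃ ρ : (Fin m → Fin n → X) × ((Fin n → Y) → Fin m) → ℝ, IsDist ρ ∧
      (codeOut W ρ = fun ys => ∏ i, outDist P W (ys i)) ∧
      codeErr W ρ ≤ n * (∑ x, ∑ y, P x * W x y * Real.log (W x y / outDist P W y) ^ 2) /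
        (n * mutInfo P W - g) ^ 2 + m / Real.exp g := by
  classical
  have hm' : (0 : ℝ) < m := by exact_mod_cast hm
  have hp := isDist_pi fun _ : Fin n => hP
  obtain ⟨dec, hdec⟩ := exists_decoder_sum_le
    (V := fun (xs : Fin n → X) (ys : Fin n → Y) => ∏ i, W (xs i) (ys i))
    (fun xs => isDist_pi fun i => hW (xs i)) hp hm (Real.exp_pos g)
  rw [outDist_pi] at hdec
  have hpf := isDist_pi fun _ : Fin m => hp
  let ρ : (Fin m → Fin n → X) × ((Fin n → Y) → Fin m) → ℝ := fun c =>
    if c.2 = dec c.1 then ∏ j, ∏ i, P (c.1 j i) else 0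
  have hρ : ∀ F : (Fin m → Fin n → X) × ((Fin n → Y) → Fin m) → ℝ,
      ∑ c, ρ c * F c = ∑ f : Fin m → Fin n → X, (∏ j, ∏ i, P (f j i)) * F (f, dec f) := by
    intro F
    rw [Fintype.sum_prod_type]
    simp [ρ]
  refine ⟨ρ, ⟨fun c => ?_, ?_⟩, ?_, ?_⟩
  · simp only [ρ]
    split_ifs
    · exact hpf.1 c.1
    · rfl
  · have := hρ fun _ => 1
    simp only [mul_one] at this
    rw [this, hpf.2]
  · funext ys
    unfold codeOut
    rw [hρ]
    have : ∀ j : Fin m, ∑ f : Fin m → Fin n → X, (∏ j, ∏ i, P (f j i)) * ∏ i, W (f j i) (ys i)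
        = ∏ i, outDist P W (ys i) := fun j => by
      rw [sum_pi_prod_mul (fun _ : Fin m => hp) j fun xs => ∏ i, W (xs i) (ys i)]
      exact congrFun (outDist_pi P W n) ys
    calc _ = (m : ℝ)⁻¹ * ∑ j, ∑ f : Fin m → Fin n → X,
          (∏ j, ∏ i, P (f j i)) * ∏ i, W (f j i) (ys i) := by
          rw [Finset.sum_comm, Finset.mul_sum]
          refine Finset.sum_congr rfl fun f _ => ?_
          rw [← Finset.mul_sum]; ring
      _ = _ := by
          simp_rw [this]
          simp [hm'.ne']
  · unfold codeErr
    rw [hρ]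
    exact hdec.trans (add_le_add_left (sum_infoDensity_tail_le hW hP n hg) _)

theorem continuous_outDist {X Y : Type*} [Fintype X] (W : X → Y → ℝ) (y : Y) :
    Continuous fun P : X → ℝ => outDist P W y := by
  unfold outDist
  fun_prop

theorem continuous_relEnt_outDist {X Y : Type*} [Fintype X] [Fintype Y] (W : X → Y → ℝ)
    {q : Y → ℝ} (hq : ∀ y, 0 < q y) : Continuous fun P : X → ℝ => relEnt (outDist P W) q := by
  have h : ∀ P : X → ℝ, relEnt (outDist P W) q = ∑ y, (outDist P W y * Real.log (outDist P W y)
      - outDist P W y * Real.log (q y)) := by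
    refine fun P => Finset.sum_congr rfl fun y _ => ?_
    by_cases h : outDist P W y = 0
    · simp [h]
    · rw [Real.log_div h (hq y).ne']; ring
  simp_rw [h]
  exact continuous_finsetSum _ fun y _ =>
    (Real.continuous_mul_log.comp (continuous_outDist W y)).sub
      ((continuous_outDist W y).mul continuous_const)

theorem continuousOn_mutInfo {X Y : Type*} [Fintype X] [Fintype Y] {W : X → Y → ℝ}
    (hW : ∀ x, IsDist (W x)) : ContinuousOn (fun P : X → ℝ => mutInfo P W) {P | IsDist P} := by
  have h : ∀ P ∈ {P : X → ℝ | IsDist P}, mutInfo P W =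
      (∑ x, ∑ y, P x * (W x y * Real.log (W x y)))
        - ∑ y, outDist P W y * Real.log (outDist P W y) := by
    intro P hP
    have h1 : ∑ y, outDist P W y * Real.log (outDist P W y)
        = ∑ x, ∑ y, P x * W x y * Real.log (outDist P W y) := by
      rw [Finset.sum_comm]
      refine Finset.sum_congr rfl fun y _ => ?_
      rw [← Finset.sum_mul]; rfl
    rw [h1, ← Finset.sum_sub_distrib]
    refine Finset.sum_congr rfl fun x _ => ?_
    rw [← Finset.sum_sub_distrib]
    refine Finset.sum_congr rfl fun y _ => ?_
    rcases (hP.1 x).eq_or_lt with hx | hx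
    · simp [← hx]
    rcases ((hW x).1 y).eq_or_lt with hy | hy
    · simp [← hy]
    rw [Real.log_div hy.ne' (outDist_pos hW hP hx hy).ne']; ring
  refine ContinuousOn.congr (Continuous.continuousOn ?_) h
  refine Continuous.sub (by fun_prop) ?_
  exact continuous_finsetSum _ fun y _ =>
    Real.continuous_mul_log.comp (continuous_outDist W y)

theorem isDist_single {X : Type*} [Fintype X] [DecidableEq X] (x0 : X) :
    IsDist (Pi.single x0 1 : X → ℝ) := by
  refine ⟨fun x => ?_, by simp⟩
  by_cases h : x = x0
  · subst h; simp
  · simp [h]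

theorem outDist_single {X Y : Type*} [Fintype X] [DecidableEq X] (W : X → Y → ℝ) (x0 : X) :
    outDist (Pi.single x0 1) W = W x0 := by
  funext y
  simp [outDist, Pi.single_apply]

theorem relEnt_self {Y : Type*} [Fintype Y] {q : Y → ℝ} (hq : ∀ y, 0 < q y) : relEnt q q = 0 := by
  simp [relEnt, fun y => div_self (hq y).ne']

theorem mutInfo_single {X Y : Type*} [Fintype X] [Fintype Y] [DecidableEq X] {W : X → Y → ℝ}
    {x0 : X} (hq : ∀ y, 0 < W x0 y) : mutInfo (Pi.single x0 1) W = 0 := by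
  unfold mutInfo
  rw [outDist_single, Finset.sum_eq_single x0 (fun x _ hx => by simp [hx]) (by simp)]
  simp [fun y => div_self (hq y).ne']

/-- A capacity-achieving input distribution under a covertness constraint exists. -/
theorem exists_isDist_max_mutInfo {X Y : Type*} [Fintype X] [Fintype Y] {W : X → Y → ℝ} {x0 : X}
    (hW : ∀ x, IsDist (W x)) (hsupp : ∀ y, 0 < W x0 y) {r : ℝ} (hr : 0 ≤ r) :
    ∃ P : X → ℝ, IsDist P ∧ relEnt (outDist P W) (W x0) ≤ r ∧ 0 ≤ mutInfo P W ∧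
      ∀ P' : X → ℝ, IsDist P' → relEnt (outDist P' W) (W x0) ≤ r →
        mutInfo P' W ≤ mutInfo P W := by
  classical
  let K : Set (X → ℝ) := stdSimplex ℝ X ∩ {P | relEnt (outDist P W) (W x0) ≤ r}
  have hK : IsCompact K := (isCompact_stdSimplex ℝ X).inter_right
    (isClosed_le (continuous_relEnt_outDist W hsupp) continuous_const)
  have h0 : (Pi.single x0 1 : X → ℝ) ∈ K :=
    ⟨isDist_single x0, by simp only [Set.mem_ofPred_eq, outDist_single, relEnt_self hsupp, hr]⟩
  obtain ⟨P, hP, hmax⟩ := hK.exists_isMaxOn ⟨_, h0⟩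
    ((continuousOn_mutInfo hW).mono fun P hP => hP.1)
  exact ⟨P, hP.1, hP.2, (mutInfo_single hsupp).symm.le.trans (hmax h0),
    fun P' h1 h2 => hmax ⟨h1, h2⟩⟩

section Kmax

variable {X Y : Type*} [Fintype X] [Fintype Y] [DecidableEq Y] {W : X → Y → ℝ} {x0 : X}
  {δ ε : ℝ}

theorem log_card_le (hW : ∀ x, IsDist (W x)) (hsupp : ∀ y, 0 < W x0 y) (hε : ε < 1) {n : ℕ}
    (hn : 0 < n) {I : ℝ} (hI : ∀ P : X → ℝ, IsDist P → relEnt (outDist P W) (W x0) ≤ δ / n →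
      mutInfo P W ≤ I) {m : ℕ} (hm : 0 < m)
    {ρ : (Fin m → Fin n → X) × ((Fin n → Y) → Fin m) → ℝ} (hρ : IsDist ρ)
    (hD : relEnt (codeOut W ρ) (fun ys : Fin n → Y => ∏ i, W x0 (ys i)) ≤ δ)
    (herr : codeErr W ρ ≤ ε) : Real.log m ≤ (n * I + Real.log 2) / (1 - ε) := by
  have hn' : (0 : ℝ) < n := by exact_mod_cast hn
  obtain ⟨P, hP, h1, h2⟩ := exists_isDist_of_code hW hsupp hn hm hρ
  have h3 := hI P hP (by rw [le_div_iff₀ hn', mul_comm]; exact h1.trans hD)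
  have h4 : 0 ≤ Real.log m := Real.log_natCast_nonneg m
  rw [le_div_iff₀ (by linarith)]
  nlinarith [mul_le_mul_of_nonneg_left h3 hn'.le]

theorem Kmax_le (hW : ∀ x, IsDist (W x)) (hsupp : ∀ y, 0 < W x0 y) (hε : ε < 1) {n : ℕ}
    (hn : 0 < n) {I : ℝ} (hI0 : 0 ≤ I) (hI : ∀ P : X → ℝ, IsDist P →
      relEnt (outDist P W) (W x0) ≤ δ / n → mutInfo P W ≤ I) :
    Kmax W x0 δ ε n ≤ (n * I + Real.log 2) / (1 - ε) := by
  refine Real.sSup_le ?_ (div_nonneg (by positivity) (by linarith))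
  rintro k ⟨m, hm, ρ, h0, h1, hD, herr, rfl⟩
  exact log_card_le hW hsupp hε hn hI hm ⟨h0, h1⟩ hD herr

theorem Kmax_nonneg (W : X → Y → ℝ) (x0 : X) (δ ε : ℝ) (n : ℕ) : 0 ≤ Kmax W x0 δ ε n := by
  refine Real.sSup_nonneg ?_
  rintro k ⟨m, hm, ρ, h0, h1, hD, herr, rfl⟩
  exact Real.log_natCast_nonneg m

theorem log_card_le_Kmax (hW : ∀ x, IsDist (W x)) (hsupp : ∀ y, 0 < W x0 y) (hδ : 0 ≤ δ)
    (hε : ε < 1) {n : ℕ} (hn : 0 < n) {m : ℕ} (hm : 0 < m)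
    {ρ : (Fin m → Fin n → X) × ((Fin n → Y) → Fin m) → ℝ} (hρ : IsDist ρ)
    (hD : relEnt (codeOut W ρ) (fun ys : Fin n → Y => ∏ i, W x0 (ys i)) ≤ δ)
    (herr : codeErr W ρ ≤ ε) : Real.log m ≤ Kmax W x0 δ ε n := by
  obtain ⟨P, -, -, -, hmax⟩ := exists_isDist_max_mutInfo hW hsupp (div_nonneg hδ n.cast_nonneg)
  refine le_csSup ⟨(n * mutInfo P W + Real.log 2) / (1 - ε), ?_⟩
    ⟨m, hm, ρ, hρ.1, hρ.2, hD, herr, rfl⟩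
  rintro k ⟨m, hm, ρ, h0, h1, hD, herr, rfl⟩
  exact log_card_le hW hsupp hε hn hmax hm ⟨h0, h1⟩ hD herr

theorem tendsto_sqrt_natCast_mul (hδ : 0 < δ) :
    Tendsto (fun n : ℕ => √(n * δ)) atTop atTop :=
  Real.tendsto_sqrt_atTop.comp (tendsto_natCast_atTop_atTop.atTop_mul_const hδ)

theorem sqrt_div_mul_sqrt (hδ : 0 < δ) (n : ℕ) : √(n / δ) * √(n * δ) = n := by
  rw [← Real.sqrt_mul (by positivity), show (n : ℝ) / δ * (n * δ) = n * n by field_simp,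
    Real.sqrt_mul_self n.cast_nonneg]

/-- Covert random coding attains every rate below that of a feasible sequence of inputs. -/
theorem eventually_le_Kmax_div (hW : ∀ x, IsDist (W x)) (hsupp : ∀ y, 0 < W x0 y) (hδ : 0 < δ)
    (hε0 : 0 < ε) (hε : ε < 1) {P : ℕ → X → ℝ} (hP : ∀ n, IsDist (P n))
    (hD : ∀ n : ℕ, 0 < n → relEnt (outDist (P n) W) (W x0) ≤ δ / n) {a a' : ℝ} (ha' : 0 < a')
    (haa : a' < a) (ha : ∀ᶠ n : ℕ in atTop, a < √(n / δ) * mutInfo (P n) W) :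
    ∀ᶠ n : ℕ in atTop, a' ≤ Kmax W x0 δ ε n / √(n * δ) := by
  have ha0 : 0 < a := ha'.trans haa
  set T : ℝ := 1 + ∑ y, 4 / W x0 y with hT
  have hT4 : ∀ y, 4 / W x0 y ≤ T := fun y => by
    have := Finset.single_le_sum (f := fun y => 4 / W x0 y)
      (fun y _ => (div_pos four_pos (hsupp y)).le) (Finset.mem_univ y)
    linarith
  have hT1 : 1 ≤ T := by
    have := Finset.sum_nonneg fun y (_ : y ∈ Finset.univ) => (div_pos four_pos (hsupp y)).le
    linarith
  set κ : ℝ := (a - a') / (2 * a) with hκ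
  have hκ0 : 0 < κ := div_pos (sub_pos.2 haa) (by positivity)
  have hlim : Tendsto (fun s : ℝ => 4 * T / (κ ^ 2 * (a * s)) + 2 * Real.exp (-((a - a') / 2 * s)))
      atTop (𝓝 0) := by
    have h1 : Tendsto (fun s : ℝ => 4 * T / (κ ^ 2 * (a * s))) atTop (𝓝 0) :=
      tendsto_const_nhds.div_atTop ((tendsto_id.const_mul_atTop ha0).const_mul_atTop (by positivity))
    have h2 : Tendsto (fun s : ℝ => Real.exp (-((a - a') / 2 * s))) atTop (𝓝 0) :=
      Real.tendsto_exp_neg_atTop_nhds_zero.comp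
        (tendsto_id.const_mul_atTop (half_pos (sub_pos.2 haa)))
    simpa using h1.add (h2.const_mul 2)
  filter_upwards [ha, eventually_gt_atTop 0,
    tendsto_natCast_atTop_atTop.eventually (eventually_ge_atTop (δ * T)),
    (hlim.comp (tendsto_sqrt_natCast_mul hδ)).eventually (eventually_lt_nhds hε0)]
    with n han hn hnT herr
  simp only [Function.comp] at herr
  have hn' : (0 : ℝ) < n := by exact_mod_cast hn
  have hs : 0 < √(n * δ) := Real.sqrt_pos.2 (by positivity)
  have hz : a * √(n * δ) < n * mutInfo (P n) W := by
    calc _ < √(n / δ) * mutInfo (P n) W * √(n * δ) := mul_lt_mul_of_pos_right han hs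
      _ = _ := by rw [mul_right_comm, sqrt_div_mul_sqrt hδ]
  set s := √(n * δ)
  set z := n * mutInfo (P n) W with hzdef
  have hz0 : 0 < z := (mul_pos ha0 hs).trans hz
  have hQd := isDist_outDist hW (hP n)
  have hQ4 : ∀ y, W x0 y / 4 ≤ outDist (P n) W y := fun y => by
    refine div_four_le_of_relEnt_le hQd (hW x0) hsupp y ((hD n hn).trans ?_)
    have h1 := (mul_le_mul_of_nonneg_left (hT4 y) hδ.le).trans hnT
    rw [mul_div_assoc', div_le_iff₀ (hsupp y)] at h1
    rw [div_le_div_iff₀ hn' four_pos]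
    linarith
  have hQpos : ∀ y, 0 < outDist (P n) W y := fun y =>
    (div_pos (hsupp y) four_pos).trans_le (hQ4 y)
  have hWT : ∀ x y, W x y ≤ T * outDist (P n) W y := fun x y => by
    have h1 : W x y ≤ 1 := (hW x).2 ▸ Finset.single_le_sum (fun y _ => (hW x).1 y)
      (Finset.mem_univ y)
    have h2 := mul_le_mul (hT4 y) (hQ4 y) (div_pos (hsupp y) four_pos).le (by linarith)
    have h3 : 4 / W x0 y * (W x0 y / 4) = 1 := by
      have := (hsupp y).ne'
      field_simp
    linarith
  have hV := sum_mul_log_sq_le hW (hP n) hQpos hT1 hWT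
  have hm : 0 < ⌈Real.exp (a' * s)⌉₊ := Nat.ceil_pos.2 (Real.exp_pos _)
  have hgz : κ * z ≤ z - (a + a') / 2 * s := by
    have h1 : z - κ * z = (a + a') / (2 * a) * z := by rw [hκ]; field_simp; ring
    have h2 : (a + a') / 2 * s = (a + a') / (2 * a) * (a * s) := by field_simp
    have h3 : (a + a') / (2 * a) * (a * s) ≤ (a + a') / (2 * a) * z :=
      mul_le_mul_of_nonneg_left hz.le (by positivity)
    linarith
  have hg : (a + a') / 2 * s < z := by
    have := mul_pos hκ0 hz0
    linarith
  obtain ⟨ρ, hρ, hout, hcerr⟩ := exists_random_code hW (hP n) n hm hg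
  have hE1 : n * (∑ x, ∑ y, P n x * W x y * Real.log (W x y / outDist (P n) W y) ^ 2) /
      (z - (a + a') / 2 * s) ^ 2 ≤ 4 * T / (κ ^ 2 * (a * s)) := by
    calc _ ≤ 4 * T * z / (κ * z) ^ 2 := by
          have h1 := mul_le_mul_of_nonneg_left hV hn'.le
          refine div_le_div₀ (by positivity) (by rw [hzdef]; linarith) (by positivity)
            (pow_le_pow_left₀ (by positivity) hgz 2)
      _ = 4 * T / (κ ^ 2 * z) := by field_simp
      _ ≤ _ := by gcongr
  have hE2 : (⌈Real.exp (a' * s)⌉₊ : ℝ) / Real.exp ((a + a') / 2 * s)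
      ≤ 2 * Real.exp (-((a - a') / 2 * s)) := by
    have h1 := (Nat.ceil_lt_add_one (Real.exp_pos (a' * s)).le).le
    have h2 := Real.one_le_exp (mul_pos ha' hs).le
    rw [div_le_iff₀ (Real.exp_pos _), mul_assoc, ← Real.exp_add,
      show -((a - a') / 2 * s) + (a + a') / 2 * s = a' * s by ring]
    linarith
  have hK := log_card_le_Kmax hW hsupp hδ.le hε hn hm hρ (ε := ε) (by
      rw [hout, relEnt_pi hQd hsupp, mul_comm, ← le_div_iff₀ hn']
      exact hD n hn) (by linarith)
  rw [le_div_iff₀ hs]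
  refine le_trans ?_ hK
  rw [Real.le_log_iff_exp_le (by exact_mod_cast hm)]
  exact Nat.le_ceil _

end Kmax

theorem statement1 {X Y : Type*} [Fintype X] [Fintype Y] [DecidableEq Y]
    (W : X → Y → ℝ) (x0 : X) (hW : ∀ x, IsDist (W x)) (hsupp : ∀ y, 0 < W x0 y)
    (δ : ℝ) (hδ : 0 < δ) (L : EReal) (hL : IsL W x0 δ L) :
    IsGreatest {v : EReal | ∃ P : ℕ → X → ℝ, (∀ n, IsDist (P n)) ∧
      (∀ n : ℕ, 0 < n → relEnt (outDist (P n) W) (W x0) ≤ δ / n) ∧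
      v = liminf (fun n : ℕ => ((Real.sqrt (n / δ) * mutInfo (P n) W : ℝ) : EReal)) atTop} L := by
  have hε1 : ∀ᶠ ε : ℝ in 𝓝[>] 0, 0 < ε ∧ ε < 1 :=
    Ioo_mem_nhdsGT one_pos
  have hub : ∀ P : ℕ → X → ℝ, (∀ n, IsDist (P n)) →
      (∀ n : ℕ, 0 < n → relEnt (outDist (P n) W) (W x0) ≤ δ / n) →
      liminf (fun n : ℕ => ((√(n / δ) * mutInfo (P n) W : ℝ) : EReal)) atTop ≤ L := by
    intro P hP hD
    by_contra! hlt
    have hL0 : (0 : EReal) ≤ L := ge_of_tendsto hL <| Eventually.of_forall fun ε =>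
      le_liminf_of_le (by isBoundedDefault) <| Eventually.of_forall fun n =>
        EReal.coe_nonneg.2 (div_nonneg (Kmax_nonneg W x0 δ ε n) (Real.sqrt_nonneg _))
    obtain ⟨a', hLa', ha'⟩ := EReal.lt_iff_exists_real_btwn.1 hlt
    obtain ⟨a, haa, ha⟩ := EReal.lt_iff_exists_real_btwn.1 ha'
    have ha'0 : 0 < a' := by exact_mod_cast hL0.trans_lt hLa'
    have hev : ∀ᶠ n : ℕ in atTop, a < √(n / δ) * mutInfo (P n) W :=
      (eventually_lt_of_lt_liminf ha).mono fun n hn => by exact_mod_cast hn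
    refine hLa'.not_ge (ge_of_tendsto hL (hε1.mono fun ε hε => ?_))
    refine le_liminf_of_le (by isBoundedDefault) ?_
    refine (eventually_le_Kmax_div hW hsupp hδ hε.1 hε.2 hP hD ha'0
      (by exact_mod_cast haa) hev).mono fun n hn => ?_
    exact_mod_cast hn
  choose P hP hD hI0 hmax using fun n : ℕ =>
    exists_isDist_max_mutInfo hW hsupp (div_nonneg hδ.le n.cast_nonneg : 0 ≤ δ / n)
  refine ⟨⟨P, hP, fun n _ => hD n, le_antisymm ?_ (hub P hP fun n _ => hD n)⟩, ?_⟩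
  · by_contra! hlt
    obtain ⟨b, hb, hbL⟩ := EReal.lt_iff_exists_real_btwn.1 hlt
    obtain ⟨b₀, hb₀, hb₀b⟩ := EReal.lt_iff_exists_real_btwn.1 hb
    obtain ⟨b₁, hb₁, hb₁b⟩ := exists_between (EReal.coe_lt_coe_iff.1 hb₀b)
    have hfreq := frequently_lt_of_liminf_lt (by isBoundedDefault) hb₀
    have hsmall : ∀ᶠ n : ℕ in atTop, Real.log 2 / √(n * δ) < b₁ - b₀ :=
      (tendsto_const_nhds.div_atTop (tendsto_sqrt_natCast_mul hδ)).eventually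
        (eventually_lt_nhds (sub_pos.2 hb₁))
    have hεb : ∀ᶠ ε : ℝ in 𝓝[>] 0, b₁ / (1 - ε) < b := by
      have : Tendsto (fun ε : ℝ => b₁ / (1 - ε)) (𝓝 0) (𝓝 (b₁ / (1 - 0))) :=
        (continuousAt_const.div (by fun_prop) (by norm_num)).tendsto
      rw [sub_zero, div_one] at this
      exact (this.eventually (eventually_lt_nhds hb₁b)).filter_mono nhdsWithin_le_nhds
    refine hbL.not_ge (le_of_tendsto hL ?_)
    filter_upwards [hε1, hεb] with ε hε hεb
    refine liminf_le_of_frequently_le ?_ (by isBoundedDefault)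
    refine (hfreq.and_eventually (hsmall.and (eventually_gt_atTop 0))).mono ?_
    rintro n ⟨hn1, hn2, hn⟩
    have hn1' : √(n / δ) * mutInfo (P n) W < b₀ := by exact_mod_cast hn1
    have hs : 0 < √(n * δ) := Real.sqrt_pos.2 (by positivity)
    have hK := Kmax_le hW hsupp hε.2 hn (hI0 n) (hmax n)
    have h1ε : 0 < 1 - ε := sub_pos.2 hε.2
    rw [EReal.coe_le_coe_iff]
    refine le_trans ?_ hεb.le
    rw [div_le_iff₀ hs, div_mul_eq_mul_div]
    refine hK.trans (div_le_div_of_nonneg_right ?_ h1ε.le)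
    rw [div_lt_iff₀ hs] at hn2
    have h3 := mul_lt_mul_of_pos_right hn1' hs
    rw [mul_right_comm, sqrt_div_mul_sqrt hδ] at h3
    linarith
  · rintro v ⟨P', hP', hD', rfl⟩
    exact hub P' hP' hD'
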